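/- arXiv:2307.12441 — 5 statements merged into one kernel-verified Lean document; each statement's English description precedes it below -/
import Mathlib

section
/- Let F : ℝ^d → ℝ be differentiable with L-Lipschitz gradient, L > 0. Fix x ∈ ℝ^d with ∇F(x) ≠ 0, a real number m̃ with 0 < m̃ ≤ 1, and a unit vector ω ∈ ℝ^d satisfying ⟨ω, ∇F(x)/‖∇F(x)‖⟩ ≥ (1 + m̃)/2. Set p = ‖∇F(x)‖·ω. Then for every step size h > 0, F(x − h·p) ≤ F(x) − (1/2)·(1 + m̃ − L·h)·h·‖∇F(x)‖². -/
open RealInnerProductSpace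

/-- Half-descent estimate for a random direction `p = ‖∇F(x)‖ • ω` whose
orientation `ω` lies in the spherical cap `⟪ω, ∇F(x)/‖∇F(x)‖⟫ ≥ (1 + m̃)/2`. -/
theorem sbrd_half_descent {d : ℕ} (hd : 1 ≤ d) (F : EuclideanSpace ℝ (Fin d) → ℝ)
    (hF : Differentiable ℝ F) (L : ℝ) (hL : 0 < L)
    (hLip : ∀ x y : EuclideanSpace ℝ (Fin d),
      ‖gradient F x - gradient F y‖ ≤ L * ‖x - y‖)
    (x : EuclideanSpace ℝ (Fin d)) (hx : gradient F x ≠ 0)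
    (m : ℝ) (hm0 : 0 < m) (hm1 : m ≤ 1)
    (ω : EuclideanSpace ℝ (Fin d)) (hω : ‖ω‖ = 1)
    (halign : ⟪ω, ‖gradient F x‖⁻¹ • gradient F x⟫ ≥ (1 + m) / 2)
    (p : EuclideanSpace ℝ (Fin d)) (hp : p = ‖gradient F x‖ • ω) :
    ∀ h : ℝ, 0 < h →
      F (x - h • p) ≤ F x - (1 / 2) * (1 + m - L * h) * h * ‖gradient F x‖ ^ 2 := by
  intro h hh
  set g := gradient F x with hg
  have hgpos : 0 < ‖g‖ := norm_pos_iff.mpr hx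
  have hpn : ‖p‖ = ‖g‖ := by rw [hp, norm_smul, hω]; simp
  have hin : ‖g‖ ^ 2 * ((1 + m) / 2) ≤ ⟪g, p⟫ := by
    have h1 : ⟪g, p⟫ = ‖g‖ ^ 2 * ⟪ω, ‖g‖⁻¹ • g⟫ := by
      rw [hp, inner_smul_right, inner_smul_right, real_inner_comm]
      field_simp
    rw [h1]
    exact mul_le_mul_of_nonneg_left halign (by positivity)
  have hder : ∀ t : ℝ, HasDerivAt
      (fun t : ℝ => F (x - t • p) + (‖g‖ ^ 2 * ((1 + m) / 2) * t - L * ‖g‖ ^ 2 / 2 * t ^ 2))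
      (-⟪gradient F (x - t • p), p⟫ + (‖g‖ ^ 2 * ((1 + m) / 2) - L * ‖g‖ ^ 2 * t)) t := by
    intro t
    have h1 : HasDerivAt (fun t : ℝ => x - t • p) (-p) t := by
      simpa using ((hasDerivAt_id t).smul_const p).const_sub x
    have h2 := (hF (x - t • p)).hasGradientAt.hasFDerivAt.comp_hasDerivAt t h1
    have h3 := ((hasDerivAt_id t).const_mul (‖g‖ ^ 2 * ((1 + m) / 2))).sub
      (((hasDerivAt_id t).pow 2).const_mul (L * ‖g‖ ^ 2 / 2))
    refine (h2.add h3).congr_deriv ?_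
    simp [InnerProductSpace.toDual_apply_apply]
    ring
  have hanti := antitoneOn_of_deriv_nonpos (convex_Ici (0 : ℝ))
    (fun t _ => (hder t).continuousAt.continuousWithinAt)
    (fun t _ => (hder t).differentiableAt.differentiableWithinAt) (by
      intro t ht
      rw [interior_Ici] at ht
      have ht : 0 < t := ht
      rw [(hder t).deriv]
      have h1 : ⟪g - gradient F (x - t • p), p⟫ ≤ L * ‖g‖ ^ 2 * t := by
        calc _ ≤ ‖g - gradient F (x - t • p)‖ * ‖p‖ := real_inner_le_norm _ _
          _ ≤ (L * ‖x - (x - t • p)‖) * ‖p‖ :=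
            mul_le_mul_of_nonneg_right (hLip _ _) (norm_nonneg _)
          _ = L * ‖g‖ ^ 2 * t := by
            rw [sub_sub_cancel, norm_smul, hpn, Real.norm_of_nonneg ht.le]; ring
      rw [inner_sub_left] at h1
      linarith)
  have := hanti (Set.mem_Ici.mpr le_rfl) (Set.mem_Ici.mpr hh.le) hh.le
  simp only [zero_smul, sub_zero] at this
  nlinarith [this]
end

section
/- Let F : ℝ^d → ℝ be differentiable with L-Lipschitz gradient, L > 0. Fix x ∈ ℝ^d with ∇F(x) ≠ 0, a real number m̃ with 0 < m̃ ≤ 1, a real number λ with 0 < λ < 1, and a unit vector ω ∈ ℝ^d satisfying ⟨ω, ∇F(x)/‖∇F(x)‖⟩ ≥ (1 + m̃)/2. Set p = ‖∇F(x)‖·ω. Then for every step size h with 0 < h < (1 + m̃·(1 − λ))/L (in particular for every 0 < h < 1/L), the descent property F(x − h·p) ≤ F(x) − (1/2)·λ·m̃·h·‖∇F(x)‖² holds. -/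
open RealInnerProductSpace

/-- Descent property for the SBRD random direction: for every step size
`0 < h < (1 + m̃·(1 − λ))/L` (in particular for every `0 < h < 1/L`),
`F(x − h·p) ≤ F(x) − (1/2)·λ·m̃·h·‖∇F(x)‖²`. -/
theorem sbrd_descent_property {d : ℕ} (hd : 1 ≤ d) (F : EuclideanSpace ℝ (Fin d) → ℝ)
    (hF : Differentiable ℝ F) (L : ℝ) (hL : 0 < L)
    (hLip : ∀ x y : EuclideanSpace ℝ (Fin d),
      ‖gradient F x - gradient F y‖ ≤ L * ‖x - y‖)
    (x : EuclideanSpace ℝ (Fin d)) (hx : gradient F x ≠ 0)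
    (m : ℝ) (hm0 : 0 < m) (hm1 : m ≤ 1)
    (lam : ℝ) (hlam0 : 0 < lam) (hlam1 : lam < 1)
    (ω : EuclideanSpace ℝ (Fin d)) (hω : ‖ω‖ = 1)
    (halign : ⟪ω, ‖gradient F x‖⁻¹ • gradient F x⟫ ≥ (1 + m) / 2)
    (p : EuclideanSpace ℝ (Fin d)) (hp : p = ‖gradient F x‖ • ω) :
    ∀ h : ℝ, 0 < h → h < (1 + m * (1 - lam)) / L →
      F (x - h • p) ≤ F x - (1 / 2) * lam * m * h * ‖gradient F x‖ ^ 2 := by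
  intro h hh0 hh1
  set g := gradient F x with hg
  have hG : 0 < ‖g‖ := norm_pos_iff.mpr hx
  have hpn : ‖p‖ = ‖g‖ := by rw [hp, norm_smul, hω]; simp
  have hc : (1 + m) / 2 * ‖g‖ ^ 2 ≤ ⟪g, p⟫ := by
    rw [inner_smul_right, real_inner_comm] at halign
    rw [hp, inner_smul_right]
    have h1 : ⟪g, ω⟫ = ‖g‖ * (‖g‖⁻¹ * ⟪g, ω⟫) := by field_simp
    rw [h1]
    nlinarith [mul_le_mul_of_nonneg_left halign (sq_nonneg ‖g‖)]
  have hder : ∀ t : ℝ, HasDerivAt (fun t : ℝ => F (x - t • p)) (-⟪gradient F (x - t • p), p⟫) t := by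
    intro t
    have h1 : HasDerivAt (fun t : ℝ => x - t • p) (-p) t := by
      simpa using ((hasDerivAt_id t).smul_const p).const_sub x
    have h2 := (hF (x - t • p)).hasGradientAt.hasFDerivAt.comp_hasDerivAt t h1
    simpa [Function.comp_def] using h2
  have hB : ∀ t : ℝ, HasDerivAt (fun t : ℝ => F x - t * ⟪g, p⟫ + L * ‖g‖ ^ 2 / 2 * t ^ 2)
      (-⟪g, p⟫ + L * ‖g‖ ^ 2 * t) t := by
    intro t
    have h1 := (((hasDerivAt_id t).mul_const ⟪g, p⟫).const_sub (F x)).add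
      ((hasDerivAt_pow 2 t).const_mul (L * ‖g‖ ^ 2 / 2))
    refine h1.congr_deriv ?_
    push_cast
    ring
  have key := image_le_of_deriv_right_le_deriv_boundary (a := 0) (b := h)
    (fun t _ => (hder t).continuousAt.continuousWithinAt)
    (fun t _ => (hder t).hasDerivWithinAt) (by simp)
    (fun t _ => (hB t).continuousAt.continuousWithinAt)
    (fun t _ => (hB t).hasDerivWithinAt) (by
      intro t ht
      have h1 := real_inner_le_norm (g - gradient F (x - t • p)) p
      have h2 := hLip x (x - t • p)
      rw [inner_sub_left] at h1
      rw [sub_sub_cancel, norm_smul, hpn, Real.norm_of_nonneg ht.1] at h2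
      rw [hpn] at h1
      have h3 := mul_le_mul_of_nonneg_right h2 hG.le
      nlinarith) (Set.right_mem_Icc.mpr hh0.le)
  rw [lt_div_iff₀ hL] at hh1
  have e1 := mul_le_mul_of_nonneg_left hc hh0.le
  have e2 := mul_le_mul_of_nonneg_left hh1.le (mul_nonneg hh0.le (sq_nonneg ‖g‖))
  nlinarith
end

section
/- Let F : ℝ^d → ℝ be differentiable with L-Lipschitz gradient, L > 0. Fix x ∈ ℝ^d with ∇F(x) ≠ 0, real numbers m̃ with 0 < m̃ ≤ 1, λ with 0 < λ < 1, γ with 0 < γ < 1, and a vector p ∈ ℝ^d with ‖p‖ = ‖∇F(x)‖ and ⟨p, ∇F(x)⟩ ≥ ((1 + m̃)/2)·‖∇F(x)‖². Suppose h > 0 is a step size at which the backtracking stopping condition fails one refinement earlier, i.e., F(x − (h/γ)·p) > F(x) − (1/2)·λ·m̃·(h/γ)·‖∇F(x)‖². Then h > γ/L. -/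
open RealInnerProductSpace

/-- Lower bound on the backtracking step size: if the backtracking stopping
condition fails at step size `h/γ`, then `h > γ/L`. -/
theorem backtracking_step_lower_bound {d : ℕ} (hd : 1 ≤ d)
    (F : EuclideanSpace ℝ (Fin d) → ℝ)
    (hF : Differentiable ℝ F) (L : ℝ) (hL : 0 < L)
    (hLip : ∀ x y : EuclideanSpace ℝ (Fin d),
      ‖gradient F x - gradient F y‖ ≤ L * ‖x - y‖)
    (x : EuclideanSpace ℝ (Fin d)) (hx : gradient F x ≠ 0)
    (m : ℝ) (hm0 : 0 < m) (hm1 : m ≤ 1)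
    (lam : ℝ) (hlam0 : 0 < lam) (hlam1 : lam < 1)
    (γ : ℝ) (hγ0 : 0 < γ) (hγ1 : γ < 1)
    (p : EuclideanSpace ℝ (Fin d)) (hpnorm : ‖p‖ = ‖gradient F x‖)
    (hpalign : ⟪p, gradient F x⟫ ≥ ((1 + m) / 2) * ‖gradient F x‖ ^ 2)
    (h : ℝ) (hh : 0 < h)
    (hfail : F (x - (h / γ) • p) >
      F x - (1 / 2) * lam * m * (h / γ) * ‖gradient F x‖ ^ 2) :
    h > γ / L := by
  set g := gradient F x with hg
  have hd1 : ∀ s : ℝ, HasDerivAt (fun s : ℝ => F (x - s • p))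
      (-⟪gradient F (x - s • p), p⟫) s := by
    intro s
    have h1 := (hF (x - s • p)).hasGradientAt.hasFDerivAt
    have h2 : HasDerivAt (fun s : ℝ => x - s • p) (-p) s := by
      simpa using ((hasDerivAt_id s).smul_const p).const_sub x
    have h3 := h1.comp_hasDerivAt s h2
    simpa [Function.comp_def] using h3
  have hd2 : ∀ s : ℝ, HasDerivAt (fun s : ℝ => F x - s * ⟪g, p⟫ + L * ‖p‖ ^ 2 / 2 * s ^ 2)
      (-⟪g, p⟫ + L * ‖p‖ ^ 2 * s) s := by
    intro s
    have h1 := (((hasDerivAt_id s).mul_const ⟪g, p⟫).const_sub (F x)).add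
      (((hasDerivAt_id s).pow 2).const_mul (L * ‖p‖ ^ 2 / 2))
    refine h1.congr_deriv ?_
    simp
    ring
  have ht : 0 < h / γ := div_pos hh hγ0
  have key : F (x - (h / γ) • p) ≤
      F x - (h / γ) * ⟪g, p⟫ + L * ‖p‖ ^ 2 / 2 * (h / γ) ^ 2 := by
    refine image_le_of_deriv_right_le_deriv_boundary (a := 0) (b := h / γ)
      (f := fun s : ℝ => F (x - s • p))
      (B := fun s : ℝ => F x - s * ⟪g, p⟫ + L * ‖p‖ ^ 2 / 2 * s ^ 2)
      (fun s _ => (hd1 s).continuousAt.continuousWithinAt)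
      (fun s _ => (hd1 s).hasDerivWithinAt) (by simp)
      (fun s _ => (hd2 s).continuousAt.continuousWithinAt)
      (fun s _ => (hd2 s).hasDerivWithinAt) ?_ (Set.right_mem_Icc.2 ht.le)
    intro s hs
    have h1 := real_inner_le_norm (g - gradient F (x - s • p)) p
    have h2 := hLip x (x - s • p)
    rw [sub_sub_cancel, norm_smul, Real.norm_of_nonneg hs.1] at h2
    have h3 := mul_le_mul_of_nonneg_right h2 (norm_nonneg p)
    rw [inner_sub_left] at h1
    linarith
  rw [real_inner_comm, hpnorm] at key
  have hG : 0 < ‖g‖ ^ 2 := by positivity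
  set t := h / γ with htdef
  have h4 := mul_le_mul_of_nonneg_left hpalign ht.le
  have h5 : 0 < (t * ‖g‖ ^ 2) * (L * t - (1 + m) + lam * m) := by nlinarith
  have h6 := (pos_iff_pos_of_mul_pos h5).1 (by positivity)
  have h7 : 1 < L * t := by nlinarith
  have h8 : h = t * γ := by rw [htdef]; field_simp
  rw [gt_iff_lt, div_lt_iff₀ hL, h8]
  nlinarith
end

section
/- Let F : ℝ^d → ℝ be differentiable with L-Lipschitz gradient, L > 0. Fix x ∈ ℝ^d with ∇F(x) ≠ 0, real numbers m̃ with 0 < m̃ ≤ 1, λ with 0 < λ < 1, γ with 0 < γ < 1, and a vector p ∈ ℝ^d with ‖p‖ = ‖∇F(x)‖ and ⟨p, ∇F(x)⟩ ≥ ((1 + m̃)/2)·‖∇F(x)‖². Suppose h > 0 satisfies the accepted backtracking condition F(x − h·p) ≤ F(x) − (1/2)·λ·m̃·h·‖∇F(x)‖² while the condition fails at step size h/γ, i.e., F(x − (h/γ)·p) > F(x) − (1/2)·λ·m̃·(h/γ)·‖∇F(x)‖². Then the precise descent property holds: F(x − h·p) ≤ F(x) − (γ/(2L))·λ·m̃·‖∇F(x)‖².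 -/
open RealInnerProductSpace

/-- The descent lemma along the ray `t ↦ x − t·p`. -/
theorem sbrd_descent_aux {d : ℕ} (F : EuclideanSpace ℝ (Fin d) → ℝ)
    (hF : Differentiable ℝ F) (L : ℝ)
    (hLip : ∀ x y : EuclideanSpace ℝ (Fin d),
      ‖gradient F x - gradient F y‖ ≤ L * ‖x - y‖)
    (x p : EuclideanSpace ℝ (Fin d)) (s : ℝ) (hs : 0 ≤ s) :
    F (x - s • p) ≤ F x - s * ⟪p, gradient F x⟫ + L * s ^ 2 / 2 * ‖p‖ ^ 2 := by
  have hder : ∀ t : ℝ, HasDerivAt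
      (fun t : ℝ => F (x - t • p) + t * ⟪p, gradient F x⟫ - L * t ^ 2 / 2 * ‖p‖ ^ 2)
      (-⟪gradient F (x - t • p), p⟫ + ⟪p, gradient F x⟫ - L * t * ‖p‖ ^ 2) t := by
    intro t
    have h1 : HasDerivAt (fun t : ℝ => x - t • p) (-p) t := by
      simpa using ((hasDerivAt_id t).smul_const p).const_sub x
    have h2 := (hF (x - t • p)).hasGradientAt.hasFDerivAt.comp_hasDerivAt t h1
    have h3 : HasDerivAt (fun t : ℝ => F (x - t • p)) (-⟪gradient F (x - t • p), p⟫) t := by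
      simpa [Function.comp_def] using h2
    have h4 : HasDerivAt (fun t : ℝ => t * ⟪p, gradient F x⟫) ⟪p, gradient F x⟫ t := by
      simpa using (hasDerivAt_id t).mul_const ⟪p, gradient F x⟫
    have h5 : HasDerivAt (fun t : ℝ => L * t ^ 2 / 2 * ‖p‖ ^ 2) (L * t * ‖p‖ ^ 2) t := by
      have h6 := (((hasDerivAt_pow 2 t).const_mul L).div_const 2).mul_const (‖p‖ ^ 2)
      refine h6.congr_deriv ?_
      norm_num
      ring_nf
      try simp
    exact (h3.add h4).sub h5
  have hanti : AntitoneOn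
      (fun t : ℝ => F (x - t • p) + t * ⟪p, gradient F x⟫ - L * t ^ 2 / 2 * ‖p‖ ^ 2)
      (Set.Ici 0) := by
    apply antitoneOn_of_deriv_nonpos (convex_Ici 0)
    · exact fun t _ => (hder t).continuousAt.continuousWithinAt
    · exact fun t _ => (hder t).differentiableAt.differentiableWithinAt
    · intro t ht
      rw [interior_Ici] at ht
      have ht0 : 0 < t := ht
      rw [(hder t).deriv]
      have e1 : ⟪gradient F x - gradient F (x - t • p), p⟫ =
          ⟪p, gradient F x⟫ - ⟪gradient F (x - t • p), p⟫ := by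
        rw [inner_sub_left, real_inner_comm p (gradient F x)]
      have e2 := real_inner_le_norm (gradient F x - gradient F (x - t • p)) p
      have e3 := hLip x (x - t • p)
      rw [sub_sub_cancel, norm_smul, Real.norm_of_nonneg ht0.le] at e3
      have e4 := mul_le_mul_of_nonneg_right e3 (norm_nonneg p)
      nlinarith
  have := hanti (Set.mem_Ici.2 le_rfl) (Set.mem_Ici.2 hs) hs
  have h0 : F (x - (0:ℝ) • p) = F x := by rw [zero_smul, sub_zero]
  simp only [h0] at this
  linarith

/-- The precise descent property produced by the backtracking line search:
`F(x − h·p) ≤ F(x) − (γ/(2L))·λ·m̃·‖∇F(x)‖²`. -/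
theorem sbrd_precise_descent {d : ℕ} (hd : 1 ≤ d)
    (F : EuclideanSpace ℝ (Fin d) → ℝ)
    (hF : Differentiable ℝ F) (L : ℝ) (hL : 0 < L)
    (hLip : ∀ x y : EuclideanSpace ℝ (Fin d),
      ‖gradient F x - gradient F y‖ ≤ L * ‖x - y‖)
    (x : EuclideanSpace ℝ (Fin d)) (hx : gradient F x ≠ 0)
    (m : ℝ) (hm0 : 0 < m) (hm1 : m ≤ 1)
    (lam : ℝ) (hlam0 : 0 < lam) (hlam1 : lam < 1)
    (γ : ℝ) (hγ0 : 0 < γ) (hγ1 : γ < 1)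
    (p : EuclideanSpace ℝ (Fin d)) (hpnorm : ‖p‖ = ‖gradient F x‖)
    (hpalign : ⟪p, gradient F x⟫ ≥ ((1 + m) / 2) * ‖gradient F x‖ ^ 2)
    (h : ℝ) (hh : 0 < h)
    (haccept : F (x - h • p) ≤ F x - (1 / 2) * lam * m * h * ‖gradient F x‖ ^ 2)
    (hfail : F (x - (h / γ) • p) >
      F x - (1 / 2) * lam * m * (h / γ) * ‖gradient F x‖ ^ 2) :
    F (x - h • p) ≤ F x - (γ / (2 * L)) * lam * m * ‖gradient F x‖ ^ 2 := by
  have hs : 0 < h / γ := div_pos hh hγ0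
  have hdesc := sbrd_descent_aux F hF L hLip x p (h / γ) hs.le
  rw [hpnorm] at hdesc
  have hG : 0 < ‖gradient F x‖ ^ 2 := by positivity
  set G := ‖gradient F x‖ ^ 2 with hGdef
  have hal := mul_le_mul_of_nonneg_left hpalign hs.le
  have hlm : lam * m ≤ m := by nlinarith
  have key : 1 < L * (h / γ) := by
    by_contra hc
    push Not at hc
    have h1 : 0 < h / γ * G := mul_pos hs hG
    have h2 : h / γ * G * (L * (h / γ)) ≤ h / γ * G * 1 :=
      mul_le_mul_of_nonneg_left hc h1.le
    have h3 : h / γ * G * (lam * m) ≤ h / γ * G * m := mul_le_mul_of_nonneg_left hlm h1.le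
    nlinarith
  have hle : γ / (2 * L) ≤ 1 / 2 * h := by
    rw [← mul_div_assoc, lt_div_iff₀ hγ0] at key
    rw [div_le_iff₀ (by positivity)]
    linarith
  have hfin : γ / (2 * L) * (lam * m * G) ≤ 1 / 2 * h * (lam * m * G) :=
    mul_le_mul_of_nonneg_right hle (by positivity)
  linarith
end

section
/- Let F : ℝ^d → ℝ be differentiable, let X* ∈ ℝ^d, and let μ > 0, C > 0, q ≥ 1, and β with 1 < β ≤ 2. Let X : ℕ → ℝ^d be a sequence such that for every n: F(X(n)) > F(X*), the Łojasiewicz inequality μ·(F(X(n)) − F(X*)) ≤ ‖∇F(X(n))‖^β holds, and F(X(n+1)) ≤ F(X(n)) − (1/C)·‖∇F(X(n))‖^{2(q+1)}. Set β' = β/(2(q+1) − β) and E(0) = F(X(0)) − F(X*). Then for every n ≥ 0, F(X(n)) − F(X*) ≤ ( E(0)^{−1/β'} + (1/(β'·C))·μ^{2(q+1)/β}·n )^{−β'}. -/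
lemma sbrd_step (a b s K : ℝ) (ha : 0 < a) (hb : 0 < b) (hs : 0 < s)
    (h : b ≤ a - K * a ^ (1 + s)) : a ^ (-s) + s * K ≤ b ^ (-s) := by
  have has : 0 < a ^ s := Real.rpow_pos_of_pos ha s
  have h1 : b / a ≤ 1 - K * a ^ s := by
    rw [div_le_iff₀ ha]
    rw [Real.rpow_add ha, Real.rpow_one] at h
    linarith
  have h2 : Real.log (b / a) ≤ b / a - 1 := Real.log_le_sub_one_of_pos (div_pos hb ha)
  have h3 : 1 + s * (K * a ^ s) ≤ (b / a) ^ (-s) := by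
    rw [Real.rpow_def_of_pos (div_pos hb ha)]
    have h4 := Real.add_one_le_exp (Real.log (b / a) * -s)
    have h5 : s * (K * a ^ s) ≤ s * (-Real.log (b / a)) :=
      mul_le_mul_of_nonneg_left (by linarith) hs.le
    linarith
  have h6 : b ^ (-s) = a ^ (-s) * (b / a) ^ (-s) := by
    rw [← Real.mul_rpow ha.le (div_pos hb ha).le, mul_div_cancel₀ _ ha.ne']
  have h7 : a ^ (-s) * a ^ s = 1 := by
    rw [← Real.rpow_add ha]; simp
  rw [h6]
  calc a ^ (-s) + s * K = a ^ (-s) + s * K * (a ^ (-s) * a ^ s) := by rw [h7, mul_one]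
    _ = a ^ (-s) * (1 + s * (K * a ^ s)) := by ring
    _ ≤ _ := mul_le_mul_of_nonneg_left h3 (Real.rpow_nonneg ha.le _)

/-- Theorem 3.3 (self-contained form): under the Łojasiewicz inequality with
flatness exponent `β ∈ (1, 2]` and the per-step descent with gradient power
`2(q+1)`, the loss error decays algebraically with rate `β' = β/(2(q+1) − β)`. -/
theorem sbrd_algebraic_convergence_rate {d : ℕ} (F : EuclideanSpace ℝ (Fin d) → ℝ)
    (hF : Differentiable ℝ F) (Xstar : EuclideanSpace ℝ (Fin d))
    (μ : ℝ) (hμ : 0 < μ) (C : ℝ) (hC : 0 < C) (q : ℝ) (hq : 1 ≤ q)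
    (β : ℝ) (hβ1 : 1 < β) (hβ2 : β ≤ 2)
    (X : ℕ → EuclideanSpace ℝ (Fin d))
    (hgt : ∀ n, F (X n) > F Xstar)
    (hLoj : ∀ n, μ * (F (X n) - F Xstar) ≤ ‖gradient F (X n)‖ ^ β)
    (hdescent : ∀ n, F (X (n + 1)) ≤
      F (X n) - (1 / C) * ‖gradient F (X n)‖ ^ (2 * (q + 1)))
    (β' : ℝ) (hβ' : β' = β / (2 * (q + 1) - β))
    (E0 : ℝ) (hE0 : E0 = F (X 0) - F Xstar) :
    ∀ n : ℕ, F (X n) - F Xstar ≤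
      (E0 ^ (-(1 / β')) + (1 / (β' * C)) * μ ^ (2 * (q + 1) / β) * n) ^ (-β') := by
  have hβ0 : 0 < β := by linarith
  have hden : 0 < 2 * (q + 1) - β := by linarith
  have hb' : 0 < β' := by rw [hβ']; exact div_pos hβ0 hden
  have hexp : 2 * (q + 1) / β = 1 + 1 / β' := by
    rw [hβ', one_div_div]; field_simp; ring
  have hs : 0 < 1 / β' := one_div_pos.mpr hb'
  have hpos : ∀ n, 0 < F (X n) - F Xstar := fun n => sub_pos.mpr (hgt n)
  have hstep : ∀ n, F (X (n + 1)) - F Xstar ≤ (F (X n) - F Xstar) -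
      (1 / C * μ ^ (2 * (q + 1) / β)) * (F (X n) - F Xstar) ^ (1 + 1 / β') := by
    intro n
    have h1 : (μ * (F (X n) - F Xstar)) ^ (2 * (q + 1) / β) ≤
        ‖gradient F (X n)‖ ^ (2 * (q + 1)) := by
      have h := Real.rpow_le_rpow (mul_pos hμ (hpos n)).le (hLoj n)
        (show 0 ≤ 2 * (q + 1) / β by positivity)
      rwa [← Real.rpow_mul (norm_nonneg _), mul_div_cancel₀ _ hβ0.ne'] at h
    rw [Real.mul_rpow hμ.le (hpos n).le] at h1
    have h2 := mul_le_mul_of_nonneg_left h1 (one_div_pos.mpr hC).le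
    have h3 := hdescent n
    rw [← hexp, mul_assoc]
    linarith
  have key : ∀ n : ℕ, E0 ^ (-(1 / β')) + (1 / (β' * C)) * μ ^ (2 * (q + 1) / β) * n ≤
      (F (X n) - F Xstar) ^ (-(1 / β')) := by
    intro n
    induction n with
    | zero => simp [hE0]
    | succ n ih =>
      have h := sbrd_step _ _ _ _ (hpos n) (hpos (n + 1)) hs (hstep n)
      have e : 1 / β' * (1 / C * μ ^ (2 * (q + 1) / β)) =
        1 / (β' * C) * μ ^ (2 * (q + 1) / β) := by field_simp
      rw [e] at h
      push_cast
      linarith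
  intro n
  have hE : 0 < E0 := by rw [hE0]; exact hpos 0
  have hL : 0 < E0 ^ (-(1 / β')) + (1 / (β' * C)) * μ ^ (2 * (q + 1) / β) * n := by
    have := Real.rpow_pos_of_pos hE (-(1 / β'))
    positivity
  have h := Real.rpow_le_rpow_of_nonpos hL (key n) (show -β' ≤ 0 by linarith)
  rw [← Real.rpow_mul (hpos n).le] at h
  have e : -(1 / β') * -β' = 1 := by field_simp
  rwa [e, Real.rpow_one] at h
end
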